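/- For unit vectors a_1,…,a_{2n} ∈ R^3, ∫_{S^2} (a_1,x)(a_2,x)⋯(a_{2n},x) dS = c_n Σ (a_{i_1},a_{i_2})⋯(a_{i_{2n-1}},a_{i_{2n}}), where the sum is over all partitions of {1,…,2n} into unordered pairs, and c_n = 2^{n+2} π n! / (2n+1)!. -/

import Mathlib

open MeasureTheory RealInnerProductSpace

lemma ltEven {n : ℕ} (k : Fin n) : 2 * k.1 < 2 * n := by omega

lemma ltOdd {n : ℕ} (k : Fin n) : 2 * k.1 + 1 < 2 * n := by omega

lemma polar {N : ℕ} {M : Type*} [AddCommGroup M] [Module ℝ M]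
    (F : MultilinearMap ℝ (fun _ : Fin N => M) ℝ) (a : Fin N → M) :
    ∑ σ : Equiv.Perm (Fin N), F (fun i => a (σ i)) =
      ∑ S : Finset (Fin N), (-1 : ℝ) ^ (Finset.univ \ S).card * F (fun _ => ∑ j ∈ S, a j) := by
  classical
  have h1 : ∀ r : Fin N → Fin N, ∑ S : Finset (Fin N),
      (if r ∈ Fintype.piFinset (fun _ : Fin N => S) then (-1 : ℝ) ^ (Finset.univ \ S).card else 0)
      = if Function.Bijective r then 1 else 0 := by
    intro r
    have := Finset.prod_add (fun _ : Fin N => (1:ℝ)) (fun j => if j ∈ Set.range r then 0 else -1)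
      Finset.univ
    rw [Finset.powerset_univ] at this
    trans ∏ j : Fin N, ((1:ℝ) + if j ∈ Set.range r then 0 else -1)
    · rw [this]
      refine Finset.sum_congr rfl fun S _ => ?_
      rw [Finset.prod_const_one, one_mul]
      split_ifs with h
      · rw [Fintype.mem_piFinset] at h
        rw [Finset.prod_congr rfl (g := fun _ => (-1:ℝ)), Finset.prod_const]
        intro j hj
        rw [if_neg]
        rintro ⟨i, rfl⟩
        simp [h i] at hj
      · rw [Fintype.mem_piFinset] at h
        push Not at h
        obtain ⟨i, hi⟩ := h
        rw [Finset.prod_eq_zero (i := r i)]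
        · simp [hi]
        · simp
    · split_ifs with h
      · refine Finset.prod_eq_one fun j _ => ?_
        rw [if_pos (show j ∈ Set.range r from h.2 j)]; simp
      · rw [← Finite.surjective_iff_bijective] at h
        unfold Function.Surjective at h
        push Not at h
        obtain ⟨j, hj⟩ := h
        rw [Finset.prod_eq_zero (Finset.mem_univ j)]
        rw [if_neg]; · simp
        rintro ⟨i, hi⟩; exact hj i hi
  have h2 : ∀ S : Finset (Fin N), (-1 : ℝ) ^ (Finset.univ \ S).card * F (fun _ => ∑ j ∈ S, a j) =
      ∑ r : Fin N → Fin N, (if r ∈ Fintype.piFinset (fun _ : Fin N => S) then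
        (-1 : ℝ) ^ (Finset.univ \ S).card else 0) * F (fun i => a (r i)) := by
    intro S
    rw [F.map_sum_finset (fun _ j => a j) (fun _ => S), Finset.mul_sum]
    simp only [ite_mul, zero_mul]
    rw [← Finset.sum_filter]
    congr 1; ext; simp
  simp_rw [h2]
  rw [Finset.sum_comm]
  simp_rw [← Finset.sum_mul, h1, ite_mul, one_mul, zero_mul]
  rw [← Finset.sum_filter]
  refine Finset.sum_bij (fun σ _ => ⇑σ) ?_ ?_ ?_ ?_
  · intro σ _; exact Finset.mem_filter.2 ⟨Finset.mem_univ _, σ.bijective⟩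
  · intro σ _ τ _ h; exact DFunLike.coe_injective h
  · intro r hr; exact ⟨Equiv.ofBijective r (Finset.mem_filter.1 hr).2, by simp, rfl⟩
  · intros; rfl

noncomputable def LL (N : ℕ) :
    MultilinearMap ℝ (fun _ : Fin N => EuclideanSpace ℝ (Fin 3)) ℝ where
  toFun a := ∫ x : Metric.sphere (0 : EuclideanSpace ℝ (Fin 3)) 1,
        (∏ i, ⟪a i, (x : EuclideanSpace ℝ (Fin 3))⟫)
        ∂(volume : Measure (EuclideanSpace ℝ (Fin 3))).toSphere
  map_update_add' := by
    intro _ m i x y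
    rw [← integral_add]
    · congr 1; ext z
      simp only [Finset.prod_eq_mul_prod_sdiff_singleton_of_mem (Finset.mem_univ i)]
      simp only [Function.update_self, inner_add_left, add_mul]
      congr 1 <;> congr 1 <;> refine Finset.prod_congr rfl fun j hj => ?_ <;>
        (have : j ≠ i := by simpa using hj) <;> simp [this]
    · apply Continuous.integrable_of_hasCompactSupport
      · fun_prop
      · exact HasCompactSupport.of_compactSpace _
    · apply Continuous.integrable_of_hasCompactSupport
      · fun_prop
      · exact HasCompactSupport.of_compactSpace _
  map_update_smul' := by
    intro _ m i c x
    rw [smul_eq_mul, ← integral_const_mul]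
    congr 1; ext z
    simp only [Finset.prod_eq_mul_prod_sdiff_singleton_of_mem (Finset.mem_univ i)]
    simp only [Function.update_self, real_inner_smul_left, mul_assoc]
    congr 2; refine Finset.prod_congr rfl fun j hj => ?_
    have : j ≠ i := by simpa using hj
    simp [this]

lemma RRaux {n : ℕ} (m : Fin (2*n) → EuclideanSpace ℝ (Fin 3)) (i : Fin (2*n)) :
   ∃ (L : EuclideanSpace ℝ (Fin 3) →ₗ[ℝ] ℝ), ∀ x, ∏ k : Fin n,
            ⟪(Function.update m i x) (⟨2*k.1, ltEven k⟩),
              (Function.update m i x) (⟨2*k.1+1, ltOdd k⟩)⟫ = L x := by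
  classical
  have hk : i.1 / 2 < n := by omega
  set k0 : Fin n := ⟨i.1/2, hk⟩ with hk0
  set C := ∏ k ∈ Finset.univ \ {k0}, ⟪m (⟨2*k.1, ltEven k⟩), m (⟨2*k.1+1, ltOdd k⟩)⟫
  have hC : ∀ x, ∏ k ∈ Finset.univ \ {k0}, ⟪(Function.update m i x) (⟨2*k.1, ltEven k⟩),
              (Function.update m i x) (⟨2*k.1+1, ltOdd k⟩)⟫ = C := by
    intro x
    refine Finset.prod_congr rfl fun k hk => ?_
    have : k ≠ k0 := by simpa using hk
    have h' : k.1 ≠ i.1 / 2 := fun h => this (Fin.ext h)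
    rw [Function.update_of_ne, Function.update_of_ne]
    · intro h; have := congrArg Fin.val h; simp at this; omega
    · intro h; have := congrArg Fin.val h; simp at this; omega
  rcases Nat.even_or_odd' i.1 with ⟨c, hc | hc⟩
  · refine ⟨C • (innerₗ _ (m ⟨2*k0.1+1, ltOdd k0⟩)), fun x => ?_⟩
    rw [Finset.prod_eq_mul_prod_sdiff_singleton_of_mem (Finset.mem_univ k0), hC]
    have e1 : (⟨2*k0.1, ltEven k0⟩ : Fin (2*n)) = i := Fin.ext (by simp [hk0]; omega)
    rw [e1, Function.update_self, Function.update_of_ne]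
    · simp [real_inner_comm, mul_comm]
    · intro h; have := congrArg Fin.val h; simp [hk0] at this; omega
  · refine ⟨C • (innerₗ _ (m ⟨2*k0.1, ltEven k0⟩)), fun x => ?_⟩
    rw [Finset.prod_eq_mul_prod_sdiff_singleton_of_mem (Finset.mem_univ k0), hC]
    have e1 : (⟨2*k0.1+1, ltOdd k0⟩ : Fin (2*n)) = i := Fin.ext (by simp [hk0]; omega)
    rw [e1, Function.update_self, Function.update_of_ne]
    · simp [mul_comm]
    · intro h; have := congrArg Fin.val h; simp [hk0] at this; omega

noncomputable def RR (n : ℕ) :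
    MultilinearMap ℝ (fun _ : Fin (2*n) => EuclideanSpace ℝ (Fin 3)) ℝ where
  toFun a := ∏ k : Fin n, ⟪a (⟨2*k.1, ltEven k⟩), a (⟨2*k.1+1, ltOdd k⟩)⟫
  map_update_add' := by
    intro h m i x y
    obtain rfl : h = instDecidableEqFin _ := Subsingleton.elim _ _
    obtain ⟨L, hL⟩ := RRaux m i
    rw [hL, hL, hL, map_add]
  map_update_smul' := by
    intro h m i c x
    obtain rfl : h = instDecidableEqFin _ := Subsingleton.elim _ _
    obtain ⟨L, hL⟩ := RRaux m i
    rw [hL, hL, map_smul]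

lemma halfInt (m : ℕ) : ∫ x in Set.Ioi (0:ℝ), x ^ (2*m) * Real.exp (-x^2)
    = (1/2) * Real.Gamma (m + 1/2) := by
  have := integral_rpow_mul_exp_neg_rpow (p := 2) (q := ((2*m : ℕ) : ℝ)) (by norm_num)
    (lt_of_lt_of_le (by norm_num) (Nat.cast_nonneg _))
  rw [show ((m:ℝ) + 1/2) = (((2*m:ℕ):ℝ)+1)/2 by push_cast; ring, ← this]
  refine setIntegral_congr_fun measurableSet_Ioi fun x _ => ?_
  simp only [Real.rpow_natCast]
  norm_num

lemma fullInt (m : ℕ) : ∫ x : ℝ, x ^ (2*m) * Real.exp (-x^2) = Real.Gamma (m + 1/2) := by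
  have := integral_comp_abs (f := fun x : ℝ => x ^ (2*m) * Real.exp (-x^2))
  simp only [sq_abs, (even_two_mul m).pow_abs] at this
  rw [this, halfInt]; ring

lemma gauss3 (m : ℕ) (a : EuclideanSpace ℝ (Fin 3)) :
    ∫ x : EuclideanSpace ℝ (Fin 3), ⟪a, x⟫ ^ (2*m) * Real.exp (-‖x‖^2)
      = ‖a‖ ^ (2*m) * (Real.pi * Real.Gamma (m + 1/2)) := by
  set e : EuclideanSpace ℝ (Fin 3) := ‖a‖ • EuclideanSpace.single 0 1 with he
  have hn : ‖a‖ = ‖e‖ := by simp [he, norm_smul]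
  set R := (ℝ ∙ (a - e))ᗮ.reflection
  have hR : R a = e := Submodule.reflection_sub hn
  have h1 := (LinearIsometryEquiv.measurePreserving R).integral_comp
    R.toHomeomorph.measurableEmbedding
    (fun x : EuclideanSpace ℝ (Fin 3) => ⟪e, x⟫ ^ (2*m) * Real.exp (-‖x‖^2))
  have h2 : ∀ x, ⟪e, R x⟫ = ⟪a, x⟫ := fun x => by rw [← hR, R.inner_map_map]
  simp only [h2, R.norm_map] at h1
  rw [h1, ← (PiLp.volume_preserving_toLp (Fin 3)).integral_comp
    (MeasurableEquiv.toLp 2 _).measurableEmbedding]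
  have h3 := integral_fintype_prod_volume_eq_prod (ι := Fin 3) (𝕜 := ℝ) (E := fun _ => ℝ)
    (fun i x => if i = 0 then x ^ (2*m) * Real.exp (-x^2) else Real.exp (-x^2))
  rw [Fin.prod_univ_three] at h3
  have hg : ∫ x : ℝ, Real.exp (-x^2) = √Real.pi := by
    simpa using integral_gaussian 1
  simp only [Fin.prod_univ_three, if_true, show (1 : Fin 3) ≠ 0 by decide,
    show (2 : Fin 3) ≠ 0 by decide, if_false, hg, fullInt] at h3
  rw [mul_assoc, Real.mul_self_sqrt Real.pi_pos.le] at h3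
  rw [mul_comm Real.pi, ← h3, ← integral_const_mul]
  congr 1; ext x
  rw [EuclideanSpace.norm_sq_eq, Fin.sum_univ_three]
  simp only [he, real_inner_smul_left, EuclideanSpace.inner_single_left, Real.norm_eq_abs, sq_abs,
    neg_add, Real.exp_add, mul_pow]
  simp
  ring

lemma sphInt (m : ℕ) (a : EuclideanSpace ℝ (Fin 3)) :
    ∫ x : Metric.sphere (0 : EuclideanSpace ℝ (Fin 3)) 1,
        ⟪a, (x : EuclideanSpace ℝ (Fin 3))⟫ ^ (2*m)
        ∂(volume : Measure (EuclideanSpace ℝ (Fin 3))).toSphere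
      = 4 * Real.pi / (2*m+1) * ‖a‖ ^ (2*m) := by
  set μ := (volume : Measure (EuclideanSpace ℝ (Fin 3)))
  set I := ∫ x : Metric.sphere (0 : EuclideanSpace ℝ (Fin 3)) 1,
        ⟪a, (x : EuclideanSpace ℝ (Fin 3))⟫ ^ (2*m) ∂μ.toSphere with hI
  have key : ∫ x : EuclideanSpace ℝ (Fin 3), ⟪a, x⟫ ^ (2*m) * Real.exp (-‖x‖^2)
      = I * ∫ r in Set.Ioi (0:ℝ), r ^ (2*(m+1)) * Real.exp (-r^2) := by
    calc
      _ = ∫ x : ({(0)}ᶜ : Set (EuclideanSpace ℝ (Fin 3))),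
          ⟪a, x.1⟫ ^ (2*m) * Real.exp (-‖x.1‖^2) ∂(μ.comap (↑)) := by
        rw [integral_subtype_comap (measurableSet_singleton _).compl
          fun x : EuclideanSpace ℝ (Fin 3) ↦ ⟪a, x⟫ ^ (2*m) * Real.exp (-‖x‖^2),
          restrict_compl_singleton]
      _ = ∫ x, ⟪a, (x.1 : EuclideanSpace ℝ (Fin 3))⟫ ^ (2*m) * (x.2.1 ^ (2*m) *
            Real.exp (-x.2.1^2)) ∂μ.toSphere.prod
              (.volumeIoiPow (Module.finrank ℝ (EuclideanSpace ℝ (Fin 3)) - 1)) := by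
        rw [← μ.measurePreserving_homeomorphUnitSphereProd.integral_comp
          (Homeomorph.measurableEmbedding _)]
        congr 1; ext x
        have hx : ‖x.1‖ ≠ 0 := norm_ne_zero_iff.2 x.2
        simp only [homeomorphUnitSphereProd_apply_snd_coe,
          homeomorphUnitSphereProd_apply_fst_coe, real_inner_smul_right, mul_pow]
        rw [← mul_assoc, mul_right_comm (_ ^ (2*m)), ← mul_pow, inv_mul_cancel₀ hx]
        simp
      _ = I * ∫ r : Set.Ioi (0:ℝ), r.1 ^ (2*m) * Real.exp (-r.1^2)
            ∂(.volumeIoiPow (Module.finrank ℝ (EuclideanSpace ℝ (Fin 3)) - 1)) :=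
        integral_prod_mul
          (fun x : Metric.sphere (0 : EuclideanSpace ℝ (Fin 3)) 1 =>
            ⟪a, (x : EuclideanSpace ℝ (Fin 3))⟫ ^ (2*m))
          (fun r : Set.Ioi (0:ℝ) => r.1 ^ (2*m) * Real.exp (-r.1^2))
      _ = _ := by
        congr 1
        simp only [Measure.volumeIoiPow, ENNReal.ofReal, finrank_euclideanSpace_fin]
        rw [integral_withDensity_eq_integral_smul,
          integral_subtype_comap measurableSet_Ioi fun r : ℝ ↦
            Real.toNNReal (r ^ (3 - 1)) • (r ^ (2*m) * Real.exp (-r^2)),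
          setIntegral_congr_fun measurableSet_Ioi fun x hx ↦ ?_]
        · rw [NNReal.smul_def, Real.coe_toNNReal _ (pow_nonneg (le_of_lt hx) _)]
          simp only [smul_eq_mul]; ring
        · exact (measurable_subtype_coe.pow_const _).real_toNNReal
  rw [gauss3, halfInt, show (((m+1:ℕ):ℝ) + 1/2) = (m + 1/2) + 1 by push_cast; ring,
    Real.Gamma_add_one (by positivity)] at key
  have hG : Real.Gamma ((m:ℝ) + 1/2) ≠ 0 := (Real.Gamma_pos_of_pos (by positivity)).ne'
  have : (2*(m:ℝ)+1) ≠ 0 := by positivity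
  rw [eq_comm, div_mul_eq_mul_div, div_eq_iff this]
  apply mul_right_cancel₀ hG
  linear_combination 4 * key


/-- For unit vectors `a₁, …, a_{2n} ∈ ℝ³`,
`∫_{S²} ⟨a₁,x⟩⋯⟨a_{2n},x⟩ dS = cₙ Σ ⟨a_{i₁},a_{i₂}⟩⋯⟨a_{i_{2n-1}},a_{i_{2n}}⟩`,
the sum being over all partitions of `{1,…,2n}` into unordered pairs and
`cₙ = 2^{n+2} π n!/(2n+1)!`.  The sum over perfect matchings is written via the
standard hafnian formula `(1/(2ⁿ n!)) Σ_{σ ∈ S_{2n}} ∏ₖ ⟨a_{σ(2k)}, a_{σ(2k+1)}⟩`,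
in which each matching is counted `2ⁿ n!` times. -/
theorem stmt_13 (n : ℕ) (a : Fin (2*n) → EuclideanSpace ℝ (Fin 3))
    (ha : ∀ i, ‖a i‖ = 1) :
    ∫ x : Metric.sphere (0 : EuclideanSpace ℝ (Fin 3)) 1,
        (∏ i, ⟪a i, (x : EuclideanSpace ℝ (Fin 3))⟫)
        ∂(volume : Measure (EuclideanSpace ℝ (Fin 3))).toSphere
      = (2^(n+2) * Real.pi * (n.factorial : ℝ) / ((2*n+1).factorial : ℝ)) *
        ((1 / (2^n * (n.factorial : ℝ))) *
          ∑ σ : Equiv.Perm (Fin (2*n)), ∏ k : Fin n,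
            ⟪a (σ ⟨2*k.1, by omega⟩), a (σ ⟨2*k.1+1, by omega⟩)⟫) := by
  set c : ℝ := 2^(n+2) * Real.pi * (n.factorial : ℝ) / ((2*n+1).factorial : ℝ) with hc
  have hL := polar (LL (2*n)) a
  have hR := polar (RR n) a
  have hsym : ∀ σ : Equiv.Perm (Fin (2*n)), LL (2*n) (fun i => a (σ i)) = LL (2*n) a := by
    intro σ
    change ∫ x : Metric.sphere (0 : EuclideanSpace ℝ (Fin 3)) 1, _ ∂_ = ∫ x, _ ∂_
    congr 1; ext x
    exact Equiv.prod_comp σ (fun i => ⟪a i, (x : EuclideanSpace ℝ (Fin 3))⟫)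
  have hdiag : ∀ b : EuclideanSpace ℝ (Fin 3), LL (2*n) (fun _ => b)
      = 4 * Real.pi / (2*n+1) * RR n (fun _ => b) := by
    intro b
    have h1 : LL (2*n) (fun _ => b) = 4 * Real.pi / (2*n+1) * ‖b‖ ^ (2*n) := by
      rw [← sphInt]
      change ∫ x : Metric.sphere (0 : EuclideanSpace ℝ (Fin 3)) 1, _ ∂_ = ∫ x, _ ∂_
      simp
    have h2 : RR n (fun _ => b) = ‖b‖ ^ (2*n) := by
      change ∏ k : Fin n, ⟪b, b⟫ = _
      simp [pow_mul]
    rw [h1, h2]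
  simp_rw [hsym] at hL
  simp_rw [hdiag, mul_left_comm _ (4 * Real.pi / (2*(n:ℝ)+1)), ← Finset.mul_sum] at hL
  rw [← hR] at hL
  change LL (2*n) a = c * ((1 / (2^n * (n.factorial : ℝ))) *
    ∑ σ : Equiv.Perm (Fin (2*n)), RR n (fun i => a (σ i)))
  rw [Finset.sum_const, Finset.card_univ, Fintype.card_perm, Fintype.card_fin, nsmul_eq_mul] at hL
  have hf : ((2*n).factorial : ℝ) ≠ 0 := by positivity
  apply mul_left_cancel₀ hf
  rw [hL, hc, Nat.factorial_succ]
  have : (n.factorial : ℝ) ≠ 0 := by positivity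
  push_cast
  field_simp
  ring
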